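/- Let K be a collapsible simplicial complex with dim(K) = 2, and let W = ⟨∅ = K_0,...,K_k = K⟩ be a Morse sequence on K whose reverse sequence ⟨K = K_k,...,K_0 = ∅⟩ is maximal, i.e., for any i ∈ [0,k−1] such that K_i is an elementary perforation of K_{i+1} (the step from K_{i+1} to K_i removes a critical face), the complex K_{i+1} admits no elementary collapse (has no free pair). Then W is perfect: W has exactly one critical face, which is a 0-simplex. -/

import Mathlib

/- Basic notions: simplicial complexes, facets, free pairs, expansions,
   fillings, collapses, Morse sequences, discrete vector fields,
   gradient paths, Morse functions. -/

variable {α : Type*} [DecidableEq α]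

/-- A (simplicial) complex: a finite family of nonempty finite sets that is
closed under taking nonempty subsets. -/
def IsComplex (K : Finset (Finset α)) : Prop :=
  ∅ ∉ K ∧ ∀ τ ∈ K, ∀ σ : Finset α, σ.Nonempty → σ ⊆ τ → σ ∈ K

/-- A facet of `K`: a face maximal for inclusion. -/
def Facet (K : Finset (Finset α)) (σ : Finset α) : Prop :=
  σ ∈ K ∧ ∀ τ ∈ K, σ ⊆ τ → τ = σ

/-- `(σ, τ)` is a free pair for `K`: `τ` is the only face of `K`
properly containing `σ`. -/
def FreePair (K : Finset (Finset α)) (σ τ : Finset α) : Prop :=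
  σ ∈ K ∧ τ ∈ K ∧ σ ⊂ τ ∧ ∀ ν ∈ K, σ ⊂ ν → ν = τ

/-- `K` is an elementary expansion of `L` (equivalently, `L` is an
elementary collapse of `K`). -/
def ElemExpansion (L K : Finset (Finset α)) : Prop :=
  ∃ σ τ : Finset α, FreePair K σ τ ∧ L = K \ {σ, τ}

/-- `K` is an elementary filling of `L` (equivalently, `L` is an
elementary perforation of `K`). -/
def ElemFilling (L K : Finset (Finset α)) : Prop :=
  ∃ σ : Finset α, Facet K σ ∧ L = K.erase σ

/-- `L` is an elementary collapse of `K`. -/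
def ElemCollapse (K L : Finset (Finset α)) : Prop := ElemExpansion L K

/-- `K` collapses onto `L`: a finite sequence of elementary collapses from `K` to `L`. -/
def CollapsesOnto (K L : Finset (Finset α)) : Prop :=
  Relation.ReflTransGen (fun A B : Finset (Finset α) => ElemCollapse A B) K L

/-- `K` is collapsible: `K` collapses onto a single vertex. -/
def Collapsible (K : Finset (Finset α)) : Prop :=
  ∃ a : α, CollapsesOnto K {({a} : Finset α)}

/-- A Morse sequence on `K`: a sequence `∅ = K_0, …, K_k = K` of simplicial
complexes where each step is an elementary expansion or an elementary filling. -/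
structure MorseSequence (K : Finset (Finset α)) where
  k : ℕ
  seq : ℕ → Finset (Finset α)
  cplx : ∀ i ≤ k, IsComplex (seq i)
  first : seq 0 = ∅
  last : seq k = K
  step : ∀ i < k, ElemExpansion (seq i) (seq (i + 1)) ∨ ElemFilling (seq i) (seq (i + 1))

/-- `σ` is a critical face of the Morse sequence `W`: it is the simplex added
by some elementary filling step of `W`. -/
def CriticalFace {K : Finset (Finset α)} (W : MorseSequence K) (σ : Finset α) : Prop :=
  ∃ i < W.k, σ ∈ W.seq (i + 1) ∧ W.seq i = (W.seq (i + 1)).erase σ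

/-- `(σ, τ)` is a regular pair of the Morse sequence `W`: it is the free pair
added by some elementary expansion step of `W`. -/
def RegularPair {K : Finset (Finset α)} (W : MorseSequence K) (σ τ : Finset α) : Prop :=
  ∃ i < W.k, FreePair (W.seq (i + 1)) σ τ ∧ W.seq i = W.seq (i + 1) \ {σ, τ}

/-- The gradient vector field of a Morse sequence: the set of its regular pairs. -/
def gradVF {K : Finset (Finset α)} (W : MorseSequence K) : Set (Finset α × Finset α) :=
  {p | RegularPair W p.1 p.2}

/-- `σ ∈ ∂τ`: `σ` is a codimension-one face of `τ`. -/
def InBoundary (σ τ : Finset α) : Prop := σ ⊆ τ ∧ σ.card + 1 = τ.card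

/-- Each simplex belongs to at most one pair of `V`. -/
def PairwiseDisjointPairs (V : Set (Finset α × Finset α)) : Prop :=
  ∀ p ∈ V, ∀ q ∈ V, (p.1 = q.1 ∨ p.1 = q.2 ∨ p.2 = q.1 ∨ p.2 = q.2) → p = q

/-- A discrete vector field on `K`. -/
def IsDVF (K : Finset (Finset α)) (V : Set (Finset α × Finset α)) : Prop :=
  (∀ p ∈ V, p.1 ∈ K ∧ p.2 ∈ K ∧ InBoundary p.1 p.2) ∧ PairwiseDisjointPairs V

/-- `ν` is critical for the discrete vector field `V`: it belongs to no pair of `V`. -/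
def CriticalForVF (V : Set (Finset α × Finset α)) (ν : Finset α) : Prop :=
  ∀ p ∈ V, ν ≠ p.1 ∧ ν ≠ p.2

/-- A `p`-gradient path `⟨σ_0, τ_0, …, σ_{k-1}, τ_{k-1}, σ_k⟩` in `V`. -/
def IsGradPath (K : Finset (Finset α)) (V : Set (Finset α × Finset α))
    (p k : ℕ) (σ τ : ℕ → Finset α) : Prop :=
  (∀ i ≤ k, σ i ∈ K ∧ (σ i).card = p + 1) ∧
  (∀ i < k, τ i ∈ K ∧ (τ i).card = p + 2) ∧
  (∀ i < k, (σ i, τ i) ∈ V ∧ σ (i + 1) ⊂ τ i ∧ σ (i + 1) ≠ σ i)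

/-- `V` is acyclic: no non-trivial closed `p`-gradient path. -/
def AcyclicVF (K : Finset (Finset α)) (V : Set (Finset α × Finset α)) : Prop :=
  ∀ (p k : ℕ) (σ τ : ℕ → Finset α), IsGradPath K V p k σ τ → 1 ≤ k → σ 0 ≠ σ k

/-- `(η, ν)` is an extension of the `p`-gradient path `(σ, τ)` of length `k` in `V`:
prepending `⟨η, ν⟩` or appending `⟨ν, η⟩` yields a `p`-gradient path in `V`. -/
def IsExtension (K : Finset (Finset α)) (V : Set (Finset α × Finset α))
    (p k : ℕ) (σ τ : ℕ → Finset α) (η ν : Finset α) : Prop :=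
  IsGradPath K V p (k + 1)
    (fun i => if i = 0 then η else σ (i - 1)) (fun i => if i = 0 then ν else τ (i - 1)) ∨
  IsGradPath K V p (k + 1)
    (fun i => if i ≤ k then σ i else η) (fun i => if i < k then τ i else ν)

/-- A maximal `p`-gradient path in `V`: one that admits no extension. -/
def MaximalPath (K : Finset (Finset α)) (V : Set (Finset α × Finset α))
    (p k : ℕ) (σ τ : ℕ → Finset α) : Prop :=
  IsGradPath K V p k σ τ ∧ ∀ η ν : Finset α, ¬ IsExtension K V p k σ τ η ν

/-- `V(f)`: the pairs `(σ, τ)` of faces of `K` with `σ ∈ ∂τ` and `f σ ≥ f τ`. -/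
def Vf (K : Finset (Finset α)) (f : Finset α → ℤ) : Set (Finset α × Finset α) :=
  {p | p.1 ∈ K ∧ p.2 ∈ K ∧ InBoundary p.1 p.2 ∧ f p.2 ≤ f p.1}

/-- `f` is a (discrete) Morse function on `K`: each simplex of `K` is in at most
one pair of `V(f)`; `V(f)` is then the gradient vector field of `f`. -/
def IsMorseFunction (K : Finset (Finset α)) (f : Finset α → ℤ) : Prop :=
  PairwiseDisjointPairs (Vf K f)

/-- `f` is a Morse function on the Morse sequence `W`. -/
def IsMorseFunctionOnSeq {K : Finset (Finset α)} (W : MorseSequence K)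
    (f : Finset α → ℤ) : Prop :=
  (∀ σc, CriticalFace W σc → ∀ σ ∈ K, InBoundary σ σc → f σ < f σc) ∧
  (∀ σ τ : Finset α, RegularPair W σ τ → f τ ≤ f σ)

/-- The canonical Morse function of a Morse sequence `W`: each simplex is sent to
the index of the step of `W` at which it is added. -/
noncomputable def canonicalMF {K : Finset (Finset α)} (W : MorseSequence K)
    (σ : Finset α) : ℤ :=
  ((sInf {i : ℕ | σ ∈ W.seq i} : ℕ) : ℤ)

/-- A basic Morse function on `K`: monotone, semi-injective and generic. -/
def IsBasicMorseFunction (K : Finset (Finset α)) (f : Finset α → ℤ) : Prop :=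
  (∀ σ ∈ K, ∀ τ ∈ K, σ ⊆ τ → f σ ≤ f τ) ∧
  (∀ i : ℤ, (K.filter fun σ => f σ = i).card ≤ 2) ∧
  (∀ σ ∈ K, ∀ τ ∈ K, f σ = f τ → σ ⊆ τ ∨ τ ⊆ σ)

/-- Two functions are strongly equivalent on `K` if they induce the same order on `K`. -/
def StronglyEquiv (K : Finset (Finset α)) (f g : Finset α → ℤ) : Prop :=
  ∀ σ ∈ K, ∀ τ ∈ K, (f σ ≤ f τ ↔ g σ ≤ g τ)

/-- `L` is maximal for `K`: no elementary expansion of `L` is a subset of `K`. -/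
def MaximalIn (K L : Finset (Finset α)) : Prop :=
  ¬ ∃ M : Finset (Finset α), ElemExpansion L M ∧ M ⊆ K

/-- A Morse sequence is maximal if a filling is performed only when no expansion
(within `K`) is possible. -/
def MaximalMorseSeq {K : Finset (Finset α)} (W : MorseSequence K) : Prop :=
  ∀ i < W.k, ElemFilling (W.seq i) (W.seq (i + 1)) → MaximalIn K (W.seq i)

/-- The number of connected components of a graph `K`: vertices `a`, `b` are
identified when `{a, b}` is an edge of `K` (hence, when they are joined by a
path of edges of `K`). -/
noncomputable def numComponents (K : Finset (Finset α)) : ℕ :=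
  Nat.card (Quot (fun a b : {x : α // ({x} : Finset α) ∈ K} =>
    ({a.1, b.1} : Finset α) ∈ K))

theorem FreePair.card_eq {K : Finset (Finset α)} {σ τ : Finset α} (hK : IsComplex K)
    (h : FreePair K σ τ) : τ.card = σ.card + 1 := by
  obtain ⟨hσ, hτ, hst, hu⟩ := h
  obtain ⟨x, hx, hxσ⟩ := Finset.exists_of_ssubset hst
  have hmem : insert x σ ∈ K :=
    hK.2 τ hτ _ (Finset.insert_nonempty x σ) (Finset.insert_subset hx hst.1)
  rw [← hu _ hmem (Finset.ssubset_insert hxσ), Finset.card_insert_of_notMem hxσ]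

set_option linter.unusedSectionVars false in
theorem FreePair.card_pos {K : Finset (Finset α)} {σ τ : Finset α} (hK : IsComplex K)
    (h : FreePair K σ τ) : 0 < σ.card := by
  rw [Finset.card_pos, Finset.nonempty_iff_ne_empty]
  rintro rfl
  exact hK.1 h.1

theorem ElemExpansion.isComplex {L K : Finset (Finset α)} (hK : IsComplex K)
    (h : ElemExpansion L K) : IsComplex L := by
  obtain ⟨σ, τ, ⟨hσ, hτ, hst, hu⟩, rfl⟩ := h
  refine ⟨fun h0 => hK.1 (Finset.mem_sdiff.1 h0).1, fun ν hν μ hμ hμν => ?_⟩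
  simp only [Finset.mem_sdiff, Finset.mem_insert, Finset.mem_singleton, not_or] at hν ⊢
  refine ⟨hK.2 ν hν.1 μ hμ hμν, ?_, ?_⟩
  · rintro rfl
    exact hν.2.2 (hu ν hν.1 (hμν.ssubset_of_ne (Ne.symm hν.2.1)))
  · rintro rfl
    exact hν.2.2 (hu ν hν.1 (hst.trans_subset hμν))

theorem ElemExpansion.subset {L K : Finset (Finset α)} (h : ElemExpansion L K) : L ⊆ K := by
  obtain ⟨σ, τ, -, rfl⟩ := h
  exact Finset.sdiff_subset

/-- The Euler characteristic of a complex. -/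
def eulerChar (K : Finset (Finset α)) : ℤ := ∑ σ ∈ K, (-1) ^ (σ.card + 1)

theorem ElemExpansion.eulerChar_eq {L K : Finset (Finset α)} (hK : IsComplex K)
    (h : ElemExpansion L K) : eulerChar L = eulerChar K := by
  obtain ⟨σ, τ, hf, rfl⟩ := h
  have hsub : ({σ, τ} : Finset (Finset α)) ⊆ K := by
    intro ν hν
    rcases Finset.mem_insert.1 hν with rfl | hν
    · exact hf.1
    · rw [Finset.mem_singleton.1 hν]
      exact hf.2.1
  unfold eulerChar
  rw [← Finset.sum_sdiff hsub, Finset.sum_pair hf.2.2.1.ne, hf.card_eq hK]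
  ring

/-- Every property of vertices that is invariant along edges is constant on the vertices. -/
def EdgeConnected (K : Finset (Finset α)) : Prop :=
  ∀ P : α → Prop, (∀ x y, {x, y} ∈ K → (P x ↔ P y)) →
    ∀ x y, {x} ∈ K → {y} ∈ K → (P x ↔ P y)

/-- The other endpoint of the edge in a free pair whose smaller face is a vertex. -/
theorem FreePair.exists_eq_pair {K : Finset (Finset α)} {v : α} {τ : Finset α}
    (hK : IsComplex K) (h : FreePair K {v} τ) : ∃ w, w ≠ v ∧ τ = {v, w} := by
  have hc := h.card_eq hK
  obtain ⟨w, hw, hwv⟩ := Finset.exists_of_ssubset h.2.2.1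
  rw [Finset.mem_singleton] at hwv
  refine ⟨w, hwv, (Finset.eq_of_subset_of_card_le ?_ ?_).symm⟩
  · exact Finset.insert_subset (h.2.2.1.1 (Finset.mem_singleton_self v))
      (Finset.singleton_subset_iff.2 hw)
  · rw [hc, Finset.card_pair (Ne.symm hwv), Finset.card_singleton]

theorem ElemExpansion.edgeConnected {L K : Finset (Finset α)} (hK : IsComplex K)
    (h : ElemExpansion L K) (hL : EdgeConnected L) : EdgeConnected K := by
  intro P hP
  have hPL := hL P fun x y hxy => hP x y (h.subset hxy)
  have key : ∀ x, {x} ∈ K → ∃ x', {x'} ∈ L ∧ (P x ↔ P x') := by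
    intro x hx
    obtain ⟨σ, τ, hf, rfl⟩ := h
    have hc := hf.card_eq hK
    have hp := hf.card_pos hK
    have hτ : ∀ z : α, {z} ≠ τ := by
      rintro z rfl
      rw [Finset.card_singleton] at hc
      omega
    by_cases hxσ : {x} = σ
    · subst hxσ
      obtain ⟨w, hwx, rfl⟩ := hf.exists_eq_pair hK
      refine ⟨w, ?_, hP x w hf.2.1⟩
      simp only [Finset.mem_sdiff, Finset.mem_insert, Finset.mem_singleton, not_or]
      exact ⟨hK.2 _ hf.2.1 _ (Finset.singleton_nonempty w) (by simp),
        by simpa using hwx, hτ w⟩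
    · refine ⟨x, ?_, Iff.rfl⟩
      simp only [Finset.mem_sdiff, Finset.mem_insert, Finset.mem_singleton, not_or]
      exact ⟨hx, hxσ, hτ x⟩
  intro x y hx hy
  obtain ⟨x', hx', hxx'⟩ := key x hx
  obtain ⟨y', hy', hyy'⟩ := key y hy
  rw [hxx', hyy', hPL x' y' hx' hy']

theorem ElemCollapse.edgeConnected {L K : Finset (Finset α)} (hK : IsComplex K)
    (h : ElemCollapse K L) (hKc : EdgeConnected K) : EdgeConnected L := by
  intro P hP
  obtain ⟨σ, τ, hf, rfl⟩ := h
  have hc := hf.card_eq hK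
  have hp := hf.card_pos hK
  by_cases h1 : σ.card = 1
  · obtain ⟨v, rfl⟩ := Finset.card_eq_one.1 h1
    obtain ⟨w, hwv, rfl⟩ := hf.exists_eq_pair hK
    have hQ := hKc (fun x => if x = v then P w else P x) ?_
    · intro x y hx hy
      simp only [Finset.mem_sdiff, Finset.mem_insert, Finset.mem_singleton, not_or,
        Finset.singleton_inj] at hx hy
      simpa [hx.2.1, hy.2.1] using hQ x y hx.1 hy.1
    · have aux : ∀ y, y ≠ v → {v, y} ∈ K → y = w := by
        intro y hy hvy
        have hvy' := hf.2.2.2 _ hvy <| (Finset.ssubset_iff_of_subset (by simp)).2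
          ⟨y, by simp, by simpa using hy⟩
        have : y ∈ ({v, w} : Finset α) := hvy' ▸ by simp
        simpa [hy] using this
      intro x y hxy
      by_cases hx : x = v <;> by_cases hy : y = v
      · simp [hx, hy]
      · subst hx
        simp [aux y hy hxy]
      · subst hy
        simp [aux x hx (Finset.pair_comm x y ▸ hxy)]
      · simp only [hx, hy, if_false]
        refine hP x y ?_
        simp only [Finset.mem_sdiff, Finset.mem_insert, Finset.mem_singleton, not_or]
        refine ⟨hxy, fun he => ?_, fun he => ?_⟩
        · have : v ∈ ({x, y} : Finset α) := he ▸ by simp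
          simp only [Finset.mem_insert, Finset.mem_singleton] at this
          tauto
        · have : v ∈ ({x, y} : Finset α) := he ▸ by simp
          simp only [Finset.mem_insert, Finset.mem_singleton] at this
          tauto
  · have hτ : ∀ x y : α, {x, y} ≠ τ := by
      rintro x y rfl
      have := Finset.card_le_two (a := x) (b := y)
      omega
    intro x y hx hy
    refine hKc P (fun x y hxy => ?_) x y (Finset.mem_sdiff.1 hx).1 (Finset.mem_sdiff.1 hy).1
    by_cases he : {x, y} = σ
    · subst he
      obtain ⟨z, hz, hzxy⟩ := Finset.exists_of_ssubset hf.2.2.1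
      have hsub := hf.2.2.1.1
      have hmem : ∀ u ∈ τ, {u, z} ∈ K \ {{x, y}, τ} := by
        intro u hu
        simp only [Finset.mem_sdiff, Finset.mem_insert, Finset.mem_singleton, not_or]
        refine ⟨hK.2 τ hf.2.1 _ (by simp) ?_, fun he => hzxy (he ▸ by simp), hτ u z⟩
        exact Finset.insert_subset hu (Finset.singleton_subset_iff.2 hz)
      exact (hP x z (hmem x (hsub (by simp)))).trans (hP y z (hmem y (hsub (by simp)))).symm
    · refine hP x y ?_
      simp only [Finset.mem_sdiff, Finset.mem_insert, Finset.mem_singleton, not_or]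
      exact ⟨hxy, he, hτ x y⟩

theorem CollapsesOnto.eulerChar_eq_and_edgeConnected {K L : Finset (Finset α)}
    (hK : IsComplex K) (h : CollapsesOnto K L) (hL : EdgeConnected L) :
    eulerChar K = eulerChar L ∧ EdgeConnected K := by
  induction h using Relation.ReflTransGen.head_induction_on with
  | refl => exact ⟨rfl, hL⟩
  | head hKM _ ih =>
    obtain ⟨he, hc⟩ := ih (ElemExpansion.isComplex hK hKM)
    exact ⟨(ElemExpansion.eulerChar_eq hK hKM).symm.trans he,
      ElemExpansion.edgeConnected hK hKM hc⟩

/-- If `K` collapses onto a vertex, then any complex of dimension `d - 1 > 0` whose faces of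
cardinality `d` all belong to `K` has a free pair. -/
theorem CollapsesOnto.exists_freePair {K : Finset (Finset α)} {a : α} {d : ℕ}
    (hK : IsComplex K) (h : CollapsesOnto K {{a}}) (hd : 1 < d)
    (hKd : ∀ σ ∈ K, σ.card ≤ d) {L : Finset (Finset α)} (hL : IsComplex L)
    (hLd : ∀ σ ∈ L, σ.card ≤ d) (hLK : ∀ σ ∈ L, σ.card = d → σ ∈ K)
    (htop : ∃ σ ∈ L, σ.card = d) : ∃ σ τ, FreePair L σ τ := by
  induction h using Relation.ReflTransGen.head_induction_on with
  | refl =>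
    obtain ⟨σ, hσ, hc⟩ := htop
    have := hLK σ hσ hc
    rw [Finset.mem_singleton] at this
    rw [this, Finset.card_singleton] at hc
    omega
  | head hKM _ ih =>
    have hM := ElemExpansion.isComplex hK hKM
    have hMK := ElemExpansion.subset hKM
    obtain ⟨σ, τ, hf, rfl⟩ := hKM
    have hc := hf.card_eq hK
    have hp := hf.card_pos hK
    have hτd := hKd τ hf.2.1
    by_cases hτ : τ ∈ L ∧ τ.card = d
    · refine ⟨σ, τ, hL.2 τ hτ.1 σ (Finset.card_pos.1 hp) hf.2.2.1.1, hτ.1, hf.2.2.1,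
        fun ν hν hσν => hf.2.2.2 ν (hLK ν hν ?_) hσν⟩
      have := Finset.card_lt_card hσν
      have := hLd ν hν
      omega
    · refine ih hM (fun ν hν => hKd ν (hMK hν)) fun ν hν hνd => ?_
      simp only [Finset.mem_sdiff, Finset.mem_insert, Finset.mem_singleton, not_or]
      refine ⟨hLK ν hν hνd, ?_, ?_⟩
      · rintro rfl
        omega
      · rintro rfl
        exact hτ ⟨hν, hνd⟩

theorem EdgeConnected.eq_singleton_of_no_freePair {L : Finset (Finset α)} (hL : IsComplex L)
    (hc : EdgeConnected L) (he : eulerChar L = 1) (hL2 : ∀ σ ∈ L, σ.card ≤ 2)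
    (hfree : ∀ σ τ, ¬ FreePair L σ τ) : ∃ a, L = {{a}} := by
  have hpos : ∀ σ ∈ L, 0 < σ.card := fun σ hσ =>
    Finset.card_pos.2 (Finset.nonempty_iff_ne_empty.2 fun h => hL.1 (h ▸ hσ))
  set V := L.filter fun σ => σ.card = 1 with hV
  set E := L.filter fun σ => ¬ σ.card = 1 with hE
  have hE2 : ∀ σ ∈ E, σ.card = 2 := by
    intro σ hσ
    rw [hE, Finset.mem_filter] at hσ
    have := hpos σ hσ.1
    have := hL2 σ hσ.1
    omega
  have hchi : (V.card : ℤ) - E.card = 1 := by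
    have h1 : ∑ σ ∈ V, (-1 : ℤ) ^ (σ.card + 1) = ∑ σ ∈ V, 1 :=
      Finset.sum_congr rfl fun σ hσ => by rw [(Finset.mem_filter.1 hσ).2]; norm_num
    have h2 : ∑ σ ∈ E, (-1 : ℤ) ^ (σ.card + 1) = ∑ σ ∈ E, -1 :=
      Finset.sum_congr rfl fun σ hσ => by rw [hE2 σ hσ]; norm_num
    rw [← he, eulerChar, ← Finset.sum_filter_add_sum_filter_not L fun σ => σ.card = 1, ← hV,
      ← hE, h1, h2]
    simp [sub_eq_add_neg]
  have hV1 : V.card ≤ 1 := by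
    by_contra! hlt
    have hdeg : ∀ v ∈ V, 2 ≤ (E.bipartiteAbove (· ⊆ ·) v).card := by
      intro σ hσ
      obtain ⟨ρ, hρ, hρσ⟩ := Finset.exists_mem_ne hlt σ
      rw [hV, Finset.mem_filter] at hσ hρ
      obtain ⟨v, rfl⟩ := Finset.card_eq_one.1 hσ.2
      obtain ⟨w, rfl⟩ := Finset.card_eq_one.1 hρ.2
      have hwv : w ≠ v := by simpa using hρσ
      have mem_star : ∀ ν ∈ L, {v} ⊂ ν → ν ∈ E.bipartiteAbove (· ⊆ ·) {v} := by
        intro ν hν hvν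
        have := Finset.card_lt_card hvν
        rw [Finset.card_singleton] at this
        rw [Finset.mem_bipartiteAbove, hE, Finset.mem_filter]
        exact ⟨⟨hν, by omega⟩, hvν.1⟩
      by_contra! hdeg
      by_cases h0 : E.bipartiteAbove (· ⊆ ·) {v} = ∅
      · have := hc (· = v) (fun x y hxy => ?_) v w hσ.1 hρ.1
        · exact hwv (this.1 rfl)
        · have hxy' : ∀ z, z ≠ v → {v, z} ∉ L := by
            intro z hz hvz
            have := mem_star _ hvz <| (Finset.ssubset_iff_of_subset (by simp)).2
              ⟨z, by simp, by simpa using hz⟩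
            simp [h0] at this
          constructor
          · rintro rfl
            by_contra hy
            exact hxy' y hy hxy
          · rintro rfl
            by_contra hx
            exact hxy' x hx (Finset.pair_comm x y ▸ hxy)
      · have h1 : (E.bipartiteAbove (· ⊆ ·) {v}).card = 1 := by
          have := Finset.card_pos.2 (Finset.nonempty_iff_ne_empty.2 h0)
          omega
        obtain ⟨τ, hτ⟩ := Finset.card_eq_one.1 h1
        have hτm : τ ∈ E.bipartiteAbove (· ⊆ ·) {v} := hτ ▸ Finset.mem_singleton_self τ
        rw [Finset.mem_bipartiteAbove, hE, Finset.mem_filter] at hτm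
        refine hfree {v} τ ⟨hσ.1, hτm.1.1, hτm.2.ssubset_of_ne ?_, fun ν hν hvν => ?_⟩
        · rintro rfl
          exact hτm.1.2 hσ.2
        · simpa [hτ] using mem_star ν hν hvν
    have hends : ∀ e ∈ E, (V.bipartiteBelow (· ⊆ ·) e).card ≤ 2 := by
      intro e he
      calc (V.bipartiteBelow (· ⊆ ·) e).card ≤ (e.powersetCard 1).card := by
            refine Finset.card_le_card fun σ hσ => ?_
            rw [Finset.mem_bipartiteBelow, hV, Finset.mem_filter] at hσ
            exact Finset.mem_powersetCard.2 ⟨hσ.2, hσ.1.2⟩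
        _ = 2 := by simp [hE2 e he]
    have := Finset.card_mul_le_card_mul (fun σ τ : Finset α => σ ⊆ τ) hdeg hends
    omega
  have hV1' : V.card = 1 := by omega
  have hE0 : E = ∅ := Finset.card_eq_zero.1 (by omega)
  obtain ⟨σ, hσ⟩ := Finset.card_eq_one.1 hV1'
  have hσV : σ ∈ V := hσ ▸ Finset.mem_singleton_self σ
  obtain ⟨a, rfl⟩ := Finset.card_eq_one.1 (Finset.mem_filter.1 hσV).2
  refine ⟨a, ?_⟩
  rw [← Finset.filter_union_filter_not_eq (fun σ => σ.card = 1) L, ← hV, ← hE, hE0, hσ,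
    Finset.union_empty]

theorem elemFilling_erase_of_isComplex {K : Finset (Finset α)} {σ : Finset α}
    (hK : IsComplex K) (hσ : σ ∈ K) (h : IsComplex (K.erase σ)) :
    ElemFilling (K.erase σ) K := by
  refine ⟨σ, ⟨hσ, fun τ hτ hστ => ?_⟩, rfl⟩
  by_contra hne
  have hσ0 : σ.Nonempty := Finset.nonempty_iff_ne_empty.2 fun h0 => hK.1 (h0 ▸ hσ)
  exact Finset.notMem_erase σ K (h.2 τ (Finset.mem_erase.2 ⟨hne, hτ⟩) σ hσ0 hστ)

theorem MorseSequence.seq_succ_nonempty {K : Finset (Finset α)} (W : MorseSequence K) {i : ℕ}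
    (hi : i < W.k) : (W.seq (i + 1)).Nonempty := by
  rcases W.step i hi with ⟨σ, τ, hf, -⟩ | ⟨σ, hf, -⟩
  · exact ⟨σ, hf.1⟩
  · exact ⟨σ, hf.1⟩

theorem MorseSequence.seq_subset {K : Finset (Finset α)} (W : MorseSequence K) {i : ℕ}
    (hi : i ≤ W.k) : W.seq i ⊆ K := by
  induction hi using Nat.decreasingInduction with
  | self => exact W.last.le
  | of_succ i hi ih =>
    refine subset_trans ?_ ih
    rcases W.step i hi with h | ⟨σ, -, h⟩
    · exact h.subset
    · exact h ▸ Finset.erase_subset _ _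

/-- Let `K` be a collapsible complex of dimension 2 and `W` a Morse
sequence on `K` whose reverse is maximal: whenever the step from `K_{i+1}` down to
`K_i` is a perforation (i.e. `K_{i+1}` is an elementary filling of `K_i`), the
complex `K_{i+1}` has no free pair. Then `W` is perfect: it has exactly one critical
face, which is a `0`-simplex. -/
theorem maximal_decreasing_on_collapsible_is_perfect {α : Type*} [DecidableEq α]
    (K : Finset (Finset α)) (hK : IsComplex K)
    (hbd : ∀ σ ∈ K, σ.card ≤ 3) (htop : ∃ σ ∈ K, σ.card = 3)
    (hcol : Collapsible K)
    (W : MorseSequence K)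
    (hmax : ∀ i < W.k, ElemFilling (W.seq i) (W.seq (i + 1)) →
      ∀ σ τ : Finset α, ¬ FreePair (W.seq (i + 1)) σ τ) :
    (∃! σ : Finset α, CriticalFace W σ) ∧
    (∀ σ : Finset α, CriticalFace W σ → σ.card = 1) := by
  obtain ⟨a, hcol⟩ := hcol
  have hpt : EdgeConnected ({{a}} : Finset (Finset α)) := by
    intro P _ x y hx hy
    rw [Finset.mem_singleton, Finset.singleton_inj] at hx hy
    rw [hx, hy]
  obtain ⟨hχ, hconn⟩ := hcol.eulerChar_eq_and_edgeConnected hK hpt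
  have hpoint : ∀ i < W.k, eulerChar (W.seq (i + 1)) = 1 → EdgeConnected (W.seq (i + 1)) →
      ElemFilling (W.seq i) (W.seq (i + 1)) → ∃ b, W.seq (i + 1) = {{b}} := by
    intro i hi he hc hfill
    have hsub := W.seq_subset (Nat.succ_le_of_lt hi)
    have hcx := W.cplx (i + 1) hi
    refine hc.eq_singleton_of_no_freePair hcx he (fun σ hσ => ?_) (hmax i hi hfill)
    by_contra hσ2
    have hσ3 := hbd σ (hsub hσ)
    obtain ⟨ρ, τ, hf⟩ := hcol.exists_freePair hK (by norm_num) hbd hcx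
      (fun σ hσ => hbd σ (hsub hσ)) (fun σ hσ _ => hsub hσ) ⟨σ, hσ, by omega⟩
    exact hmax i hi hfill ρ τ hf
  have hgood : ∀ i ≤ W.k, 0 < i → eulerChar (W.seq i) = 1 ∧ EdgeConnected (W.seq i) := by
    intro i hi
    induction hi using Nat.decreasingInduction with
    | self =>
      intro _
      rw [W.last]
      exact ⟨by simpa [eulerChar] using hχ, hconn⟩
    | of_succ i hi ih =>
      intro h0
      obtain ⟨he, hc⟩ := ih i.succ_pos
      have hcx := W.cplx (i + 1) hi
      rcases W.step i hi with h | h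
      · exact ⟨(h.eulerChar_eq hcx).trans he, ElemCollapse.edgeConnected hcx h hc⟩
      · exfalso
        obtain ⟨b, hb⟩ := hpoint i hi he hc h
        obtain ⟨j, rfl⟩ := Nat.exists_eq_succ_of_ne_zero h0.ne'
        have hne := W.seq_succ_nonempty (i := j) (by omega)
        obtain ⟨σ, hσ, h⟩ := h
        rw [hb] at hσ h
        rw [Finset.mem_singleton.1 hσ.1, Finset.erase_singleton] at h
        exact hne.ne_empty h
  have hk : 0 < W.k := by
    rw [Nat.pos_iff_ne_zero]
    intro h0
    obtain ⟨σ, hσ, -⟩ := htop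
    rw [← W.last, h0, W.first] at hσ
    exact Finset.notMem_empty σ hσ
  obtain ⟨he, hc⟩ := hgood 1 hk one_pos
  have hfill : ElemFilling (W.seq 0) (W.seq (0 + 1)) := by
    refine (W.step 0 hk).resolve_left fun h => ?_
    have := h.eulerChar_eq (W.cplx 1 hk)
    rw [he, W.first] at this
    simp [eulerChar] at this
  obtain ⟨b, hb⟩ := hpoint 0 hk he hc hfill
  have hcrit : ∀ σ, CriticalFace W σ → σ = {b} := by
    rintro σ ⟨i, hi, hσ, hi'⟩
    obtain ⟨he, hc⟩ := hgood (i + 1) hi i.succ_pos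
    have hfill : ElemFilling (W.seq i) (W.seq (i + 1)) := by
      have := W.cplx i hi.le
      rw [hi'] at this ⊢
      exact elemFilling_erase_of_isComplex (W.cplx (i + 1) hi) hσ this
    obtain ⟨c, hic⟩ := hpoint i hi he hc hfill
    rcases i with _ | j
    · rwa [hb, Finset.mem_singleton] at hσ
    · rw [hic] at hσ hi'
      rw [Finset.mem_singleton.1 hσ, Finset.erase_singleton] at hi'
      exact absurd hi' (W.seq_succ_nonempty (by omega)).ne_empty
  refine ⟨⟨{b}, ⟨0, hk, ?_, ?_⟩, hcrit⟩, fun σ hσ => ?_⟩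
  · rw [hb]
    exact Finset.mem_singleton_self _
  · rw [W.first, hb, Finset.erase_singleton]
  · rw [hcrit σ hσ, Finset.card_singleton]
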